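/- Let μ ⊢ n and λ ⊨ n, and let A_1,…,A_r be row-standard μ-tableaux of type λ which are identical in row 1. Write μ̃ = (μ_2, μ_3, …), and let Ã_1,…,Ã_r be the μ̃-tableaux obtained by deleting the first row from each A_i; these have a common type λ̃ ⊨ n − μ_1. If c_1,…,c_r ∈ 𝔽 satisfy ∑_{i=1}^r c_i φ̂_{Ã_i} = 0 (an identity of homomorphisms S^{μ̃} → M^{λ̃} over H_{n−μ_1}), then ∑_{i=1}^r c_i φ̂_{A_i} = 0 (as homomorphisms S^μ → M^λ over H_n). -/

import Mathlib

open scoped Classical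

noncomputable section

namespace FayersSemistd

/-- The value at `q` of the Gaussian (quantum) binomial coefficient polynomial
`[a choose b]`, defined via the `q`-Pascal recurrence. -/
def qBinom {F : Type*} [Field F] (q : F) : ℕ → ℕ → F
  | _, 0 => 1
  | 0, _+1 => 0
  | a+1, b+1 => qBinom q a b + q ^ (b+1) * qBinom q a (b+1)

/-- `∏_i [A_i + B_i choose A_i]_q`, where `A_i`, `B_i` are multiplicities in the
multisets `A` and `B`. -/
def qBinomProd {F : Type*} [Field F] (q : F) (A B : Multiset ℕ) : F :=
  ∏ i ∈ (A + B).toFinset, qBinom q ((A + B).count i) (A.count i)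

/-- `∑_{i<j} A_j * B_i` : the number of pairs `(x,y)` with `x ∈ A`, `y ∈ B`, `y < x`,
counted with multiplicity. -/
def invPairs (A B : Multiset ℕ) : ℕ :=
  ((A.product B).filter (fun p => p.2 < p.1)).card

/-- The Coxeter length of a permutation of `{0,…,n-1}`: its number of inversions. -/
def permLength {n : ℕ} (w : Equiv.Perm (Fin n)) : ℕ :=
  (Finset.univ.filter (fun p : Fin n × Fin n => p.1 < p.2 ∧ w p.2 < w p.1)).card

/-- `λ_0 + ⋯ + λ_{r-1}`. -/
def cumSum (lam : ℕ → ℕ) (r : ℕ) : ℕ := ∑ i ∈ Finset.range r, lam i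

/-- The (0-indexed) row of the diagram of `λ` containing the (0-indexed) position `p`,
when positions are listed row by row. -/
def rowOf (lam : ℕ → ℕ) (p : ℕ) : ℕ := sInf {r | p < cumSum lam (r+1)}

/-- `λ` is a composition of `n`: finitely many nonzero parts, summing to `n`. -/
def IsComposition (n : ℕ) (lam : ℕ → ℕ) : Prop :=
  ∃ N, (∀ r, N ≤ r → lam r = 0) ∧ cumSum lam N = n

/-- `μ` is a partition of `n`. -/
def IsPartition (n : ℕ) (mu : ℕ → ℕ) : Prop := IsComposition n mu ∧ Antitone mu

/-- The conjugate partition (0-indexed): `conjP μ i = #{r | μ r > i}`. -/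
def conjP (mu : ℕ → ℕ) (i : ℕ) : ℕ := sInf {r | mu r ≤ i}

/-- The standard Young subgroup `W_λ` of `S_n` (as a set): the permutations preserving
each consecutive block of sizes `λ_0, λ_1, …`. -/
def youngW {n : ℕ} (lam : ℕ → ℕ) : Set (Equiv.Perm (Fin n)) :=
  {w | ∀ p : Fin n, rowOf lam ((w p : Fin n) : ℕ) = rowOf lam (p : ℕ)}

/-- The adjacent transposition `(i, i+1)` (0-indexed) in `S_n`. -/
def adjT {n : ℕ} (i : ℕ) (h : i + 1 < n) : Equiv.Perm (Fin n) :=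
  Equiv.swap ⟨i, Nat.lt_of_succ_lt h⟩ ⟨i+1, h⟩

/-- `T : S_n → H` is the standard basis of an Iwahori–Hecke algebra of `S_n` over `F`
with parameter `q`.  Permutations act on the right, so the product `w·s` of the paper
is `s * w` in Mathlib's convention; the multiplication rule
`T_w T_s = T_{ws}` (length increasing) resp. `T_w T_s = q T_{ws} + (q-1) T_w`
(length decreasing) determines the algebra structure on the basis. -/
structure IsHeckeBasis {F : Type*} [Field F] {H : Type*} [Ring H] [Algebra F H] {n : ℕ}
    (q : F) (T : Equiv.Perm (Fin n) → H) : Prop where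
  li : LinearIndependent F T
  total : Submodule.span F (Set.range T) = ⊤
  one : T 1 = 1
  mul_adj_asc : ∀ (w : Equiv.Perm (Fin n)) (i : ℕ) (h : i + 1 < n),
    permLength w < permLength (adjT i h * w) →
    T w * T (adjT i h) = T (adjT i h * w)
  mul_adj_desc : ∀ (w : Equiv.Perm (Fin n)) (i : ℕ) (h : i + 1 < n),
    permLength (adjT i h * w) < permLength w →
    T w * T (adjT i h) = q • T (adjT i h * w) + (q - 1) • T w

variable {F : Type*} [Field F] {H : Type*} [Ring H] [Algebra F H] {n : ℕ}

/-- `x_λ = ∑_{w ∈ W_λ} T_w`. -/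
def xElt (T : Equiv.Perm (Fin n) → H) (lam : ℕ → ℕ) : H :=
  ∑ w ∈ Finset.univ.filter (· ∈ youngW lam), T w

/-- `y_λ = ∑_{w ∈ W_λ} (-q)^{-l(w)} T_w`. -/
def yElt (q : F) (T : Equiv.Perm (Fin n) → H) (lam : ℕ → ℕ) : H :=
  ∑ w ∈ Finset.univ.filter (· ∈ youngW lam), ((-q)⁻¹) ^ permLength w • T w

/-- The double coset `W_λ d W_μ` (paper convention: maps act on the right, so the
paper product `u·d·v` is `v * d * u` in Mathlib's convention). -/
def doubleCoset {n : ℕ} (lam mu : ℕ → ℕ) (d : Equiv.Perm (Fin n)) :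
    Set (Equiv.Perm (Fin n)) :=
  {w | ∃ u ∈ youngW (n := n) lam, ∃ v ∈ youngW (n := n) mu, w = v * d * u}

/-- `∑_{w ∈ W_λ 1_A W_μ} T_w`, the image `x_μ φ_A` of `x_μ` under the tableau
homomorphism `φ_A : M^μ → M^λ`, where `d = 1_A`. -/
def XPhi (T : Equiv.Perm (Fin n) → H) (lam mu : ℕ → ℕ) (d : Equiv.Perm (Fin n)) : H :=
  ∑ w ∈ Finset.univ.filter (· ∈ doubleCoset lam mu d), T w

/-- A row-standard tableau is recorded by the multisets of entries of its rows; it has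
shape `μ` when row `r` has `μ_r` entries. -/
def RowsOfShape (mu : ℕ → ℕ) (A : ℕ → Multiset ℕ) : Prop := ∀ r, (A r).card = mu r

/-- The tableau with rows `A 0, A 1, …` has type `λ` when the entry `v` occurs `λ_v`
times in total (entries and types are 0-indexed). -/
def HasType (A : ℕ → Multiset ℕ) (lam : ℕ → ℕ) : Prop :=
  ∀ v, (∑ᶠ r, (A r).count v) = lam v

/-- The entry in row `r`, column `c` (0-indexed) of the row-standard tableau with row
multisets `A`. -/
def entryAt (A : ℕ → Multiset ℕ) (r c : ℕ) : ℕ := ((A r).sort (· ≤ ·)).getD c 0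

/-- `d = 1_A` for the row-standard `μ`-tableau `A` of type `λ`: the tableau `t^λ d`
(whose entry at position `p` is `d p`) is row-standard (first clause), and the entry
`d p` lies in row `r` of `t^λ d` exactly when the position occupied by `d p` in `t^μ`
is occupied by `r` in `A` (second clause). -/
def Is1A {n : ℕ} (mu lam : ℕ → ℕ) (A : ℕ → Multiset ℕ) (d : Equiv.Perm (Fin n)) : Prop :=
  (∀ p p' : Fin n, rowOf lam (p : ℕ) = rowOf lam (p' : ℕ) → p < p' → d p < d p') ∧
  (∀ p : Fin n,
    entryAt A (rowOf mu ((d p : Fin n) : ℕ))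
      (((d p : Fin n) : ℕ) - cumSum mu (rowOf mu ((d p : Fin n) : ℕ)))
      = rowOf lam (p : ℕ))

/-- A row-standard tableau is semistandard if its columns are strictly increasing. -/
def Semistandard (mu : ℕ → ℕ) (A : ℕ → Multiset ℕ) : Prop :=
  ∀ r c, c < mu (r+1) → entryAt A r c < entryAt A (r+1) c

/-- The (0-indexed) column of the position `p` in the diagram of `μ`. -/
def colIdx (mu : ℕ → ℕ) (p : ℕ) : ℕ := p - cumSum mu (rowOf mu p)

/-- `w = w_μ`, i.e. `t^μ w = t_μ`: the image of position `p` is the number of positions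
coming strictly before `p` in the column-reading order of the diagram of `μ`. -/
def IsWmu {n : ℕ} (mu : ℕ → ℕ) (w : Equiv.Perm (Fin n)) : Prop :=
  ∀ p : Fin n, ((w p : Fin n) : ℕ) = (Finset.univ.filter (fun p' : Fin n =>
    colIdx mu (p' : ℕ) < colIdx mu (p : ℕ) ∨
      (colIdx mu (p' : ℕ) = colIdx mu (p : ℕ) ∧ rowOf mu (p' : ℕ) < rowOf mu (p : ℕ)))).card

def comp1 (a : ℕ) : ℕ → ℕ := fun r => if r = 0 then a else 0
def comp2 (a b : ℕ) : ℕ → ℕ := fun r => if r = 0 then a else if r = 1 then b else 0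
def comp3 (a b c : ℕ) : ℕ → ℕ :=
  fun r => if r = 0 then a else if r = 1 then b else if r = 2 then c else 0
def comp4 (a b c d : ℕ) : ℕ → ℕ :=
  fun r => if r = 0 then a else if r = 1 then b else if r = 2 then c else if r = 3 then d else 0
def rows1 (a : Multiset ℕ) : ℕ → Multiset ℕ := fun r => if r = 0 then a else 0
def rows2 (a b : Multiset ℕ) : ℕ → Multiset ℕ :=
  fun r => if r = 0 then a else if r = 1 then b else 0
def rows3 (a b c : Multiset ℕ) : ℕ → Multiset ℕ :=
  fun r => if r = 0 then a else if r = 1 then b else if r = 2 then c else 0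
def rows4 (a b c d : Multiset ℕ) : ℕ → Multiset ℕ :=
  fun r => if r = 0 then a else if r = 1 then b else if r = 2 then c else if r = 3 then d else 0

end FayersSemistd
namespace FayersSemistd

theorem adjT_apply_lt_iff {n i : ℕ} (h : i + 1 < n) {x y : Fin n} :
    adjT i h y < adjT i h x ↔
      (y < x ∧ ¬ ((y : ℕ) = i ∧ (x : ℕ) = i + 1)) ∨ ((x : ℕ) = i ∧ (y : ℕ) = i + 1) := by
  simp only [adjT, Equiv.swap_apply_def, Fin.ext_iff, Fin.lt_def]
  split_ifs <;> simp_all <;> omega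

theorem adjT_inv {n i : ℕ} (h : i + 1 < n) : (adjT i h)⁻¹ = adjT i h := by
  simp [adjT]

theorem adjT_mul_self {n i : ℕ} (h : i + 1 < n) : adjT i h * adjT i h = 1 := by
  simp [adjT]

theorem inv_adjT_mul_apply_left {n i : ℕ} (h : i + 1 < n) (w : Equiv.Perm (Fin n)) :
    (adjT i h * w)⁻¹ ⟨i, Nat.lt_of_succ_lt h⟩ = w⁻¹ ⟨i + 1, h⟩ := by
  rw [mul_inv_rev, adjT_inv]; simp [adjT]

theorem inv_adjT_mul_apply_right {n i : ℕ} (h : i + 1 < n) (w : Equiv.Perm (Fin n)) :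
    (adjT i h * w)⁻¹ ⟨i + 1, h⟩ = w⁻¹ ⟨i, Nat.lt_of_succ_lt h⟩ := by
  rw [mul_inv_rev, adjT_inv]; simp [adjT]

theorem adjT_mul_inversion_iff {n i : ℕ} (h : i + 1 < n) (w : Equiv.Perm (Fin n))
    (hw : w⁻¹ ⟨i, Nat.lt_of_succ_lt h⟩ < w⁻¹ ⟨i + 1, h⟩) (p p' : Fin n) (hp : p < p') :
    (adjT i h * w) p' < (adjT i h * w) p ↔ w p' < w p ∨
      (p = w⁻¹ ⟨i, Nat.lt_of_succ_lt h⟩ ∧ p' = w⁻¹ ⟨i + 1, h⟩) := by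
  simp only [Equiv.Perm.mul_apply, adjT_apply_lt_iff, Equiv.Perm.eq_inv_iff_eq]
  have hn : ¬ ((w p' : ℕ) = i ∧ (w p : ℕ) = i + 1) := by
    rintro ⟨h1, h2⟩
    have e1 : w p' = ⟨i, Nat.lt_of_succ_lt h⟩ := Fin.ext h1
    have e2 : w p = ⟨i + 1, h⟩ := Fin.ext h2
    rw [← e1, ← e2] at hw
    simp at hw
    exact absurd hw hp.le.not_gt
  simp only [Fin.ext_iff]
  tauto

theorem permLength_adjT_mul {n i : ℕ} (h : i + 1 < n) (w : Equiv.Perm (Fin n))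
    (hw : w⁻¹ ⟨i, Nat.lt_of_succ_lt h⟩ < w⁻¹ ⟨i + 1, h⟩) :
    permLength (adjT i h * w) = permLength w + 1 := by
  unfold permLength
  have : (Finset.univ.filter (fun p : Fin n × Fin n =>
        p.1 < p.2 ∧ (adjT i h * w) p.2 < (adjT i h * w) p.1)) =
      insert (w⁻¹ ⟨i, Nat.lt_of_succ_lt h⟩, w⁻¹ ⟨i + 1, h⟩)
        (Finset.univ.filter (fun p : Fin n × Fin n => p.1 < p.2 ∧ w p.2 < w p.1)) := by
    ext ⟨p, p'⟩
    simp only [Finset.mem_filter, Finset.mem_univ, true_and, Finset.mem_insert, Prod.mk.injEq]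
    by_cases hp : p < p'
    · rw [adjT_mul_inversion_iff h w hw p p' hp]; tauto
    · have : ¬ (p = w⁻¹ ⟨i, Nat.lt_of_succ_lt h⟩ ∧ p' = w⁻¹ ⟨i + 1, h⟩) := by
        rintro ⟨rfl, rfl⟩; exact hp hw
      tauto
  rw [this, Finset.card_insert_of_notMem]
  simp

theorem exists_descent {n : ℕ} (w : Equiv.Perm (Fin n)) (hw : w ≠ 1) :
    ∃ (i : ℕ) (h : i + 1 < n), w⁻¹ ⟨i + 1, h⟩ < w⁻¹ ⟨i, Nat.lt_of_succ_lt h⟩ := by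
  by_contra hcon
  push Not at hcon
  apply hw
  cases n with
  | zero => exact Subsingleton.elim _ _
  | succ n =>
    have hm : StrictMono (w⁻¹ : Equiv.Perm (Fin (n + 1))) := by
      rw [Fin.strictMono_iff_lt_succ]
      intro i
      refine lt_of_le_of_ne (hcon i (by omega)) ?_
      intro he
      have := (w⁻¹).injective he
      simp [Fin.ext_iff] at this
    have h1 : (w⁻¹ : Equiv.Perm (Fin (n + 1))) = 1 := by
      have := Tuple.unique_monotone (f := (id : Fin (n + 1) → Fin (n + 1))) (σ := w⁻¹) (τ := 1)
        hm.monotone monotone_id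
      ext x
      exact congrArg Fin.val (congrFun this x)
    exact inv_eq_one.mp h1

/-- Induction along a reduced expression. -/
theorem perm_reduced_induction {n : ℕ} {P : Equiv.Perm (Fin n) → Prop} (one : P 1)
    (step : ∀ (w : Equiv.Perm (Fin n)) (i : ℕ) (h : i + 1 < n),
      w⁻¹ ⟨i, Nat.lt_of_succ_lt h⟩ < w⁻¹ ⟨i + 1, h⟩ → P w → P (adjT i h * w))
    (w : Equiv.Perm (Fin n)) : P w := by
  induction hk : permLength w using Nat.strong_induction_on generalizing w with
  | _ k ih =>
    by_cases hw : w = 1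
    · exact hw ▸ one
    obtain ⟨i, h, hi⟩ := exists_descent w hw
    have e : adjT i h * (adjT i h * w) = w := by rw [← mul_assoc, adjT_mul_self, one_mul]
    have hlt : (adjT i h * w)⁻¹ ⟨i, Nat.lt_of_succ_lt h⟩ < (adjT i h * w)⁻¹ ⟨i + 1, h⟩ := by
      rw [inv_adjT_mul_apply_left, inv_adjT_mul_apply_right]; exact hi
    have hl := permLength_adjT_mul h _ hlt
    rw [e] at hl
    have := step _ i h hlt (ih _ (by omega) _ rfl)
    rwa [e] at this

theorem permLength_one {n : ℕ} : permLength (1 : Equiv.Perm (Fin n)) = 0 := by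
  simp only [permLength, Finset.card_eq_zero, Finset.filter_eq_empty_iff]
  rintro p - ⟨h1, h2⟩
  exact absurd h1 h2.le.not_gt

/-- No pair of values is inverted both by `a` and then again by `b`; equivalently the length of
`b * a` is the sum of the lengths. -/
def LengthAdditive {n : ℕ} (a b : Equiv.Perm (Fin n)) : Prop :=
  ∀ i j : Fin n, i < j → b j < b i → a⁻¹ i < a⁻¹ j

theorem LengthAdditive.of_adjT_mul {n i : ℕ} {h : i + 1 < n} {a b : Equiv.Perm (Fin n)}
    (hb : b⁻¹ ⟨i, Nat.lt_of_succ_lt h⟩ < b⁻¹ ⟨i + 1, h⟩) (hab : LengthAdditive a (adjT i h * b)) :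
    LengthAdditive a b ∧
      (b * a)⁻¹ ⟨i, Nat.lt_of_succ_lt h⟩ < (b * a)⁻¹ ⟨i + 1, h⟩ := by
  constructor
  · intro x y hxy hy
    exact hab x y hxy ((adjT_mul_inversion_iff h b hb x y hxy).mpr (Or.inl hy))
  · rw [mul_inv_rev]
    exact hab _ _ hb ((adjT_mul_inversion_iff h b hb _ _ hb).mpr (Or.inr ⟨rfl, rfl⟩))

theorem LengthAdditive.permLength_mul {n : ℕ} {a b : Equiv.Perm (Fin n)}
    (hab : LengthAdditive a b) : permLength (b * a) = permLength a + permLength b := by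
  induction b using perm_reduced_induction with
  | one => simp [permLength_one]
  | step b i h hb ih =>
    obtain ⟨h1, h2⟩ := hab.of_adjT_mul hb
    rw [mul_assoc, permLength_adjT_mul h _ h2, permLength_adjT_mul h _ hb, ih h1, add_assoc]

section Hecke

variable {F : Type*} [Field F] {H : Type*} [Ring H] [Algebra F H] {n : ℕ} {q : F}
  {T : Equiv.Perm (Fin n) → H}

theorem IsHeckeBasis.mul_asc (hT : IsHeckeBasis q T) (w : Equiv.Perm (Fin n)) (i : ℕ)
    (h : i + 1 < n) (hw : w⁻¹ ⟨i, Nat.lt_of_succ_lt h⟩ < w⁻¹ ⟨i + 1, h⟩) :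
    T w * T (adjT i h) = T (adjT i h * w) :=
  hT.mul_adj_asc w i h (by rw [permLength_adjT_mul h w hw]; exact Nat.lt_succ_self _)

theorem IsHeckeBasis.mul_desc (hT : IsHeckeBasis q T) (w : Equiv.Perm (Fin n)) (i : ℕ)
    (h : i + 1 < n) (hw : w⁻¹ ⟨i + 1, h⟩ < w⁻¹ ⟨i, Nat.lt_of_succ_lt h⟩) :
    T w * T (adjT i h) = q • T (adjT i h * w) + (q - 1) • T w := by
  refine hT.mul_adj_desc w i h ?_
  have hl := permLength_adjT_mul h (adjT i h * w)
    (by rwa [inv_adjT_mul_apply_left, inv_adjT_mul_apply_right])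
  rw [← mul_assoc, adjT_mul_self, one_mul] at hl
  omega

theorem IsHeckeBasis.mul_of_lengthAdditive (hT : IsHeckeBasis q T) {a b : Equiv.Perm (Fin n)}
    (hab : LengthAdditive a b) : T a * T b = T (b * a) := by
  induction b using perm_reduced_induction with
  | one => simp [hT.one]
  | step b i h hb ih =>
    obtain ⟨h1, h2⟩ := hab.of_adjT_mul hb
    rw [← hT.mul_asc b i h hb, ← mul_assoc, ih h1, hT.mul_asc _ i h h2, mul_assoc]

end Hecke

/-- The inclusion of the last `n - m` elements of `{0, …, n - 1}`. -/
def tailEmb (n m : ℕ) : Fin (n - m) ↪ Fin n where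
  toFun k := ⟨m + k, by omega⟩
  inj' a b h := by simpa [Fin.ext_iff] using h

/-- The inclusion of `S_{n-m}` in `S_n` acting on the last `n - m` elements. -/
def tailHom (n m : ℕ) : Equiv.Perm (Fin (n - m)) →* Equiv.Perm (Fin n) :=
  Equiv.Perm.viaEmbeddingHom (tailEmb n m)

@[simp] theorem tailEmb_val {n m : ℕ} (k : Fin (n - m)) : (tailEmb n m k : ℕ) = m + k := rfl

@[simp] theorem tailEmb_lt_tailEmb {n m : ℕ} {a b : Fin (n - m)} :
    tailEmb n m a < tailEmb n m b ↔ a < b := by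
  rw [Fin.lt_def, Fin.lt_def]; simp

theorem exists_tailEmb {n m : ℕ} (x : Fin n) (h : m ≤ x) : ∃ k, tailEmb n m k = x :=
  ⟨⟨x - m, by omega⟩, by ext; simp [h]⟩

@[simp] theorem tailHom_tailEmb {n m : ℕ} (w : Equiv.Perm (Fin (n - m))) (k : Fin (n - m)) :
    tailHom n m w (tailEmb n m k) = tailEmb n m (w k) := by
  simp [tailHom, Equiv.Perm.viaEmbeddingHom_apply, Equiv.Perm.viaEmbedding_apply]

theorem tailHom_of_lt {n m : ℕ} (w : Equiv.Perm (Fin (n - m))) (x : Fin n) (h : (x : ℕ) < m) :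
    tailHom n m w x = x := by
  rw [tailHom, Equiv.Perm.viaEmbeddingHom_apply]
  apply Equiv.Perm.viaEmbedding_apply_of_notMem
  rintro ⟨k, rfl⟩
  simp at h

theorem tailHom_inv_tailEmb {n m : ℕ} (w : Equiv.Perm (Fin (n - m))) (k : Fin (n - m)) :
    (tailHom n m w)⁻¹ (tailEmb n m k) = tailEmb n m (w⁻¹ k) := by
  rw [← map_inv, tailHom_tailEmb]

/-- Inversions of a permutation in the image of `tailHom` come from inversions in `S_{n-m}`. -/
theorem exists_of_tailHom_lt {n m : ℕ} {w : Equiv.Perm (Fin (n - m))} {x y : Fin n} (hxy : x < y)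
    (h : tailHom n m w y < tailHom n m w x) :
    ∃ a b, tailEmb n m a = x ∧ tailEmb n m b = y ∧ a < b ∧ w b < w a := by
  have hx : m ≤ x := by
    by_contra hx
    push Not at hx
    rw [tailHom_of_lt w x hx] at h
    rcases lt_or_ge (y : ℕ) m with hy | hy
    · rw [tailHom_of_lt w y hy] at h
      exact absurd h hxy.le.not_gt
    · obtain ⟨b, rfl⟩ := exists_tailEmb y hy
      rw [tailHom_tailEmb] at h
      simp only [Fin.lt_def, tailEmb_val] at h
      omega
  obtain ⟨a, rfl⟩ := exists_tailEmb x hx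
  obtain ⟨b, rfl⟩ := exists_tailEmb y (hx.trans (Fin.le_def.mp hxy.le))
  exact ⟨a, b, rfl, rfl, by simpa using hxy, by simpa using h⟩

theorem tailHom_adjT {n m i : ℕ} (h : i + 1 < n - m) :
    tailHom n m (adjT i h) = adjT (m + i) (by omega) := by
  ext x
  rcases lt_or_ge (x : ℕ) m with hx | hx
  · rw [tailHom_of_lt _ x hx, adjT, Equiv.swap_apply_of_ne_of_ne] <;>
    · rw [Ne, Fin.ext_iff]; simp only; omega
  · obtain ⟨k, rfl⟩ := exists_tailEmb x hx
    rw [tailHom_tailEmb]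
    simp only [adjT, Equiv.swap_apply_def, Fin.ext_iff, tailEmb_val]
    split_ifs <;> simp_all <;> omega

theorem tailHom_inv_lt_iff {n m i : ℕ} (h : i + 1 < n - m) (w : Equiv.Perm (Fin (n - m))) :
    ((tailHom n m w)⁻¹ ⟨m + i, by omega⟩ < (tailHom n m w)⁻¹ ⟨m + i + 1, by omega⟩ ↔
      w⁻¹ ⟨i, Nat.lt_of_succ_lt h⟩ < w⁻¹ ⟨i + 1, h⟩) ∧
    ((tailHom n m w)⁻¹ ⟨m + i + 1, by omega⟩ < (tailHom n m w)⁻¹ ⟨m + i, by omega⟩ ↔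
      w⁻¹ ⟨i + 1, h⟩ < w⁻¹ ⟨i, Nat.lt_of_succ_lt h⟩) := by
  have e1 : (⟨m + i, by omega⟩ : Fin n) = tailEmb n m ⟨i, Nat.lt_of_succ_lt h⟩ := rfl
  have e2 : (⟨m + i + 1, by omega⟩ : Fin n) = tailEmb n m ⟨i + 1, h⟩ := rfl
  rw [e1, e2, tailHom_inv_tailEmb, tailHom_inv_tailEmb]
  simp

theorem permLength_tailHom {n m : ℕ} (w : Equiv.Perm (Fin (n - m))) :
    permLength (tailHom n m w) = permLength w := by
  induction w using perm_reduced_induction with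
  | one => simp [permLength_one]
  | step w i h hw ih =>
    rw [map_mul, tailHom_adjT, permLength_adjT_mul, permLength_adjT_mul h w hw, ih]
    exact (tailHom_inv_lt_iff h w).1.mpr hw

section HeckeTail

variable {F : Type*} [Field F] {H : Type*} [Ring H] [Algebra F H]
  {H' : Type*} [Ring H'] [Algebra F H'] {n m : ℕ} {q : F}
  {T : Equiv.Perm (Fin n) → H} {T' : Equiv.Perm (Fin (n - m)) → H'}

/-- The embedding of `H_{n-m}` in `H_n` is multiplicative. -/
theorem exists_heckeTail (hT : IsHeckeBasis q T) (hT' : IsHeckeBasis q T') :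
    ∃ j : H' →ₗ[F] H, (∀ w, j (T' w) = T (tailHom n m w)) ∧ ∀ x y, j (x * y) = j x * j y := by
  let B := Module.Basis.mk hT'.li hT'.total.ge
  let j : H' →ₗ[F] H := B.constr F (fun w => T (tailHom n m w))
  have hj : ∀ w, j (T' w) = T (tailHom n m w) := by
    intro w
    have : T' w = B w := by simp [B]
    rw [this]
    exact B.constr_basis F _ w
  have hspan : ∀ (f g : H' →ₗ[F] H), (∀ w, f (T' w) = g (T' w)) → f = g := by
    intro f g h
    refine B.ext fun w => ?_
    simpa [B] using h w
  refine ⟨j, hj, ?_⟩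
  have hs : ∀ (i : ℕ) (h : i + 1 < n - m) (x : H'),
      j (x * T' (adjT i h)) = j x * j (T' (adjT i h)) := by
    intro i h x
    have : j ∘ₗ LinearMap.mulRight F (T' (adjT i h)) =
        LinearMap.mulRight F (j (T' (adjT i h))) ∘ₗ j := by
      apply hspan
      intro w
      simp only [LinearMap.comp_apply, LinearMap.mulRight_apply, hj, tailHom_adjT]
      rcases lt_trichotomy (w⁻¹ ⟨i, Nat.lt_of_succ_lt h⟩) (w⁻¹ ⟨i + 1, h⟩) with hw | hw | hw
      · rw [hT'.mul_asc w i h hw, hT.mul_asc _ _ _ ((tailHom_inv_lt_iff h w).1.mpr hw), hj,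
          map_mul, tailHom_adjT]
      · have := (w⁻¹).injective hw
        simp [Fin.ext_iff] at this
      · rw [hT'.mul_desc w i h hw, hT.mul_desc _ _ _ ((tailHom_inv_lt_iff h w).2.mpr hw), map_add,
          map_smul, map_smul, hj, hj, map_mul, tailHom_adjT]
    exact LinearMap.congr_fun this x
  have hw : ∀ (w : Equiv.Perm (Fin (n - m))) (x : H'), j (x * T' w) = j x * j (T' w) := by
    intro w
    induction w using perm_reduced_induction with
    | one => intro x; rw [hj, hT'.one, map_one, hT.one, mul_one, mul_one]
    | step w i h hlt ih =>
      intro x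
      rw [← hT'.mul_asc w i h hlt, ← mul_assoc, hs, hs, ih, mul_assoc]
  intro x y
  have : j ∘ₗ LinearMap.mulLeft F x = LinearMap.mulLeft F (j x) ∘ₗ j :=
    hspan _ _ fun w => hw w x
  exact LinearMap.congr_fun this y

end HeckeTail

theorem cumSum_succ (lam : ℕ → ℕ) (r : ℕ) : cumSum lam (r + 1) = cumSum lam r + lam r :=
  Finset.sum_range_succ _ _

theorem cumSum_succ' (lam : ℕ → ℕ) (r : ℕ) :
    cumSum lam (r + 1) = lam 0 + cumSum (fun s => lam (s + 1)) r := by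
  rw [cumSum, Finset.sum_range_succ', add_comm, cumSum]

theorem cumSum_mono (lam : ℕ → ℕ) : Monotone (cumSum lam) :=
  monotone_nat_of_le_succ fun r => by rw [cumSum_succ]; omega

theorem IsComposition.cumSum_le {n : ℕ} {lam : ℕ → ℕ} (h : IsComposition n lam) (r : ℕ) :
    cumSum lam r ≤ n := by
  obtain ⟨N, hN, rfl⟩ := h
  have key : ∀ k, cumSum lam (N + k) = cumSum lam N := by
    intro k
    induction k with
    | zero => rfl
    | succ k ih => rw [← add_assoc, cumSum_succ, hN _ (by omega), ih, add_zero]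
  exact (cumSum_mono lam (by omega : r ≤ N + r)).trans (key r).le

theorem rowOf_eq {lam : ℕ → ℕ} {p r : ℕ} (h1 : cumSum lam r ≤ p) (h2 : p < cumSum lam (r + 1)) :
    rowOf lam p = r := by
  refine le_antisymm (Nat.sInf_le h2) ?_
  by_contra hlt
  push Not at hlt
  have hmem : rowOf lam p ∈ {r | p < cumSum lam (r + 1)} := Nat.sInf_mem ⟨r, h2⟩
  exact absurd (lt_of_lt_of_le hmem (cumSum_mono lam hlt)) h1.not_gt

theorem IsComposition.rowOf_spec {n : ℕ} {lam : ℕ → ℕ} (h : IsComposition n lam) {p : ℕ}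
    (hp : p < n) : cumSum lam (rowOf lam p) ≤ p ∧ p < cumSum lam (rowOf lam p + 1) := by
  obtain ⟨N, hN, hs⟩ := h
  have hne : {r | p < cumSum lam (r + 1)}.Nonempty :=
    ⟨N, lt_of_lt_of_le (hs ▸ hp) (cumSum_mono lam (Nat.le_succ N))⟩
  have hmem : rowOf lam p ∈ {r | p < cumSum lam (r + 1)} := Nat.sInf_mem hne
  refine ⟨?_, hmem⟩
  rcases hr : rowOf lam p with _ | r
  · simp [cumSum]
  · by_contra hlt
    push Not at hlt
    have : rowOf lam p ≤ r := Nat.sInf_le hlt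
    omega

theorem IsComposition.rowOf_eq_iff {n : ℕ} {lam : ℕ → ℕ} (h : IsComposition n lam) {p r : ℕ}
    (hp : p < n) : rowOf lam p = r ↔ cumSum lam r ≤ p ∧ p < cumSum lam (r + 1) :=
  ⟨fun e => e ▸ h.rowOf_spec hp, fun e => rowOf_eq e.1 e.2⟩

theorem IsComposition.rowOf_mono {n : ℕ} {lam : ℕ → ℕ} (h : IsComposition n lam) {p p' : ℕ}
    (hpp : p ≤ p') (hp : p' < n) : rowOf lam p ≤ rowOf lam p' :=
  Nat.sInf_le (lt_of_le_of_lt hpp (h.rowOf_spec hp).2)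

theorem IsComposition.card_filter_rowOf {n : ℕ} {lam : ℕ → ℕ} (h : IsComposition n lam) (r : ℕ)
    (P : ℕ → Prop) [DecidablePred P] :
    (Finset.univ.filter (fun k : Fin n => P (k - cumSum lam r) ∧ rowOf lam k = r)).card =
      ((Finset.range (lam r)).filter P).card := by
  symm
  have hle := h.cumSum_le (r + 1)
  rw [cumSum_succ] at hle
  refine Finset.card_bij
    (fun c hc => ⟨cumSum lam r + c, by simp at hc; omega⟩) ?_ ?_ ?_
  · intro c hc
    simp only [Finset.mem_filter, Finset.mem_range, Finset.mem_univ, true_and] at hc ⊢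
    refine ⟨by simpa using hc.2, rowOf_eq (by omega) ?_⟩
    rw [cumSum_succ]; omega
  · intro a _ b _ hab
    simpa [Fin.ext_iff] using hab
  · intro k hk
    simp only [Finset.mem_filter, Finset.mem_univ, true_and] at hk
    have := (h.rowOf_eq_iff k.2).mp hk.2
    rw [cumSum_succ] at this
    exact ⟨k - cumSum lam r, by simp [hk.1]; omega, by ext; simp; omega⟩

theorem IsComposition.card_rowOf {n : ℕ} {lam : ℕ → ℕ} (h : IsComposition n lam) (r : ℕ) :
    (Finset.univ.filter (fun k : Fin n => rowOf lam k = r)).card = lam r := by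
  have := h.card_filter_rowOf r (fun _ => True)
  simpa using this

theorem IsComposition.tail {n : ℕ} {mu : ℕ → ℕ} (h : IsComposition n mu) :
    IsComposition (n - mu 0) (fun s => mu (s + 1)) := by
  obtain ⟨N, hN, hs⟩ := h
  refine ⟨N, fun r hr => hN _ (by omega), ?_⟩
  have h1 := cumSum_succ' mu N
  rw [cumSum_succ, hN N le_rfl, hs] at h1
  omega

theorem IsPartition.tail {n : ℕ} {mu : ℕ → ℕ} (h : IsPartition n mu) :
    IsPartition (n - mu 0) (fun s => mu (s + 1)) :=
  ⟨h.1.tail, fun _ _ hab => h.2 (Nat.succ_le_succ hab)⟩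

theorem rowOf_eq_zero_iff {n : ℕ} {mu : ℕ → ℕ} (h : IsComposition n mu) {p : ℕ} (hp : p < n) :
    rowOf mu p = 0 ↔ p < mu 0 := by
  rw [h.rowOf_eq_iff hp]
  simp [cumSum]

theorem rowOf_tailEmb {n : ℕ} {mu : ℕ → ℕ} (h : IsComposition n mu) (k : Fin (n - mu 0)) :
    rowOf mu (mu 0 + k) = rowOf (fun s => mu (s + 1)) k + 1 := by
  have := h.tail.rowOf_spec k.2
  apply rowOf_eq
  · rw [cumSum_succ']; omega
  · rw [cumSum_succ']; omega

theorem exists_perm_of_card_fiber {α γ : Type*} [Fintype α] (f g : α → γ)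
    (h : ∀ c, (Finset.univ.filter (fun a => f a = c)).card =
      (Finset.univ.filter (fun a => g a = c)).card) :
    ∃ σ : Equiv.Perm α, ∀ a, g (σ a) = f a := by
  have e : ∀ c, Nonempty ({a // f a = c} ≃ {a // g a = c}) := by
    intro c
    rw [← Fintype.card_eq, Fintype.card_subtype, Fintype.card_subtype]
    exact h c
  exact ⟨Equiv.ofFiberEquiv fun c => (e c).some, Equiv.ofFiberEquiv_map _⟩

theorem monotone_eq_of_card_fiber {k : ℕ} {γ : Type*} [PartialOrder γ] [DecidableEq γ]
    {f g : Fin k → γ} (hf : Monotone f) (hg : Monotone g)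
    (h : ∀ c, (Finset.univ.filter (fun a => f a = c)).card =
      (Finset.univ.filter (fun a => g a = c)).card) : f = g := by
  obtain ⟨σ, hσ⟩ := exists_perm_of_card_fiber f g fun c => by convert h c
  have e : f = g ∘ σ := funext fun a => (hσ a).symm
  have := Tuple.unique_monotone (f := g) (σ := σ) (τ := 1) (e ▸ hf) hg
  rw [e, this]; rfl

/-- Each coset of the Young subgroup attached to the monotone map `ρ` contains a unique element
along which the injective map `f` increases on every block. -/
theorem existsUnique_block_sort {k : ℕ} {β : Type*} [LinearOrder β] {ρ : Fin k → ℕ}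
    (hρ : Monotone ρ) {f : Fin k → β} (hf : Function.Injective f) :
    ∃! v : Equiv.Perm (Fin k), (∀ p, ρ (v p) = ρ p) ∧
      ∀ p p', p < p' → ρ p = ρ p' → f (v p) < f (v p') := by
  let G : Fin k → ℕ ×ₗ β := fun p => toLex (ρ p, f p)
  have hG : Function.Injective G := fun a b hab => hf (by
    have := congrArg (fun x => (ofLex x).2) hab
    exact this)
  have hmono : ∀ v : Equiv.Perm (Fin k), ((∀ p, ρ (v p) = ρ p) ∧
      ∀ p p', p < p' → ρ p = ρ p' → f (v p) < f (v p')) → Monotone (G ∘ v) := by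
    rintro v ⟨h1, h2⟩ p p' hp
    rcases hp.eq_or_lt with rfl | hp
    · exact le_rfl
    simp only [Function.comp, G, Prod.Lex.toLex_le_toLex, h1]
    rcases (hρ hp.le).lt_or_eq with hlt | heq
    · exact Or.inl hlt
    · exact Or.inr ⟨heq, (h2 p p' hp heq).le⟩
  have hs := Tuple.monotone_sort G
  have hρs : ∀ p, ρ (Tuple.sort G p) = ρ p := by
    have hm : Monotone (ρ ∘ Tuple.sort G) := by
      intro a b hab
      have := hs hab
      simp only [Function.comp, G, Prod.Lex.toLex_le_toLex] at this
      rcases this with h | h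
      · exact h.le
      · exact h.1.le
    have := Tuple.unique_monotone (f := ρ) (σ := Tuple.sort G) (τ := 1) hm hρ
    exact congrFun this
  refine ⟨Tuple.sort G, ⟨hρs, ?_⟩, ?_⟩
  · intro p p' hp he
    have h1 := hs hp.le
    simp only [Function.comp, G, Prod.Lex.toLex_le_toLex, hρs, he, lt_irrefl, false_or,
      true_and] at h1
    refine lt_of_le_of_ne h1 fun h => ?_
    exact hp.ne ((Tuple.sort G).injective (hf h))
  · intro v hv
    have := Tuple.unique_monotone (hmono v hv) hs
    ext p
    exact congrArg Fin.val (hG (congrFun this p))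

theorem card_range_getD_eq_count (l : List ℕ) (a : ℕ) :
    ((Finset.range l.length).filter (fun c => l.getD c 0 = a)).card = l.count a := by
  rw [Finset.card_filter]
  induction l with
  | nil => simp
  | cons b l ih =>
    rw [List.length_cons, Finset.sum_range_succ', List.count_cons]
    simp only [List.getD_cons_succ, List.getD_cons_zero, ih, beq_iff_eq]

theorem card_range_entryAt {mu : ℕ → ℕ} {A : ℕ → Multiset ℕ} (hA : RowsOfShape mu A) (r a : ℕ) :
    ((Finset.range (mu r)).filter (fun c => entryAt A r c = a)).card = (A r).count a := by
  have := card_range_getD_eq_count ((A r).sort (· ≤ ·)) a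
  rw [Multiset.length_sort, hA r, ← Multiset.coe_count, Multiset.sort_eq] at this
  exact this

theorem card_filter_comp_perm {α : Type*} [Fintype α] (u : Equiv.Perm α) (P : α → Prop)
    [DecidablePred P] :
    (Finset.univ.filter (fun a => P (u a))).card = (Finset.univ.filter P).card :=
  Finset.card_equiv u (by simp)

theorem youngW_inv {n : ℕ} {lam : ℕ → ℕ} {w : Equiv.Perm (Fin n)} (h : w ∈ youngW lam) :
    w⁻¹ ∈ youngW lam := by
  intro p
  have := h (w⁻¹ p)
  simpa using this.symm

/-- The double coset `W_λ 1_A W_μ` consists of the permutations for which the number of elements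
moved from each row of `λ` to each row of `μ` is prescribed by `A`. -/
theorem mem_doubleCoset_iff {n : ℕ} {mu lam : ℕ → ℕ} (hmu : IsComposition n mu)
    {A : ℕ → Multiset ℕ} (hA : RowsOfShape mu A) {d : Equiv.Perm (Fin n)} (hd : Is1A mu lam A d)
    (z : Equiv.Perm (Fin n)) :
    z ∈ doubleCoset lam mu d ↔ ∀ a r, (Finset.univ.filter
      (fun p : Fin n => rowOf lam p = a ∧ rowOf mu (z p) = r)).card = (A r).count a := by
  have hcount : ∀ a r, (Finset.univ.filter
      (fun p : Fin n => rowOf lam p = a ∧ rowOf mu (d p) = r)).card = (A r).count a := by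
    intro a r
    rw [← card_range_entryAt hA, ← hmu.card_filter_rowOf r (fun c => entryAt A r c = a),
      ← card_filter_comp_perm d
        (fun k : Fin n => entryAt A r (k - cumSum mu r) = a ∧ rowOf mu k = r)]
    congr 1
    ext p
    simp only [Finset.mem_filter, Finset.mem_univ, true_and]
    constructor <;> rintro ⟨rfl, rfl⟩
    · exact ⟨hd.2 p, rfl⟩
    · exact ⟨(hd.2 p).symm, rfl⟩
  constructor
  · rintro ⟨u, hu, v, hv, rfl⟩ a r
    rw [← hcount,
      ← card_filter_comp_perm u (fun p : Fin n => rowOf lam p = a ∧ rowOf mu (d p) = r)]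
    refine congrArg Finset.card (Finset.filter_congr fun p _ => ?_)
    rw [Equiv.Perm.mul_apply, Equiv.Perm.mul_apply, hv, hu]
  · intro hz
    obtain ⟨u, hu⟩ := exists_perm_of_card_fiber
      (fun p : Fin n => (rowOf lam p, rowOf mu (z p)))
      (fun p : Fin n => (rowOf lam p, rowOf mu (d p))) (by
        rintro ⟨a, r⟩
        simp only [Prod.mk.injEq]
        rw [hz, hcount])
    simp only [Prod.mk.injEq] at hu
    refine ⟨u, fun p => (hu p).1, z * u⁻¹ * d⁻¹, ?_, by group⟩
    intro k
    have := (hu (u⁻¹ (d⁻¹ k))).2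
    simpa using this.symm

theorem card_filter_tailEmb {n m : ℕ} (P : Fin n → Prop) [DecidablePred P] :
    (Finset.univ.filter (fun k : Fin (n - m) => P (tailEmb n m k))).card =
      (Finset.univ.filter (fun x : Fin n => P x ∧ m ≤ x)).card := by
  rw [← Finset.card_map (tailEmb n m)]
  congr 1
  ext x
  simp only [Finset.mem_map, Finset.mem_filter, Finset.mem_univ, true_and]
  constructor
  · rintro ⟨k, hk, rfl⟩
    exact ⟨hk, by simp⟩
  · rintro ⟨h1, h2⟩
    obtain ⟨k, rfl⟩ := exists_tailEmb x h2
    exact ⟨k, h1, rfl⟩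

theorem HasType.eq_head_add {n : ℕ} {mu lam lamt : ℕ → ℕ} {A : ℕ → Multiset ℕ}
    (hmu : IsComposition n mu) (hA : RowsOfShape mu A) (hlam : HasType A lam)
    (hlamt : HasType (fun s => A (s + 1)) lamt) (a : ℕ) : lam a = (A 0).count a + lamt a := by
  obtain ⟨N, hN, -⟩ := hmu
  have h0 : ∀ r, N ≤ r → (A r).count a = 0 := by
    intro r hr
    have : A r = 0 := by rw [← Multiset.card_eq_zero, hA, hN r hr]
    simp [this]
  have hsub : ∀ (f : ℕ → ℕ), (∀ r, N ≤ r → f r = 0) →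
      ∀ M, N ≤ M → ∑ᶠ r, f r = ∑ r ∈ Finset.range M, f r := by
    intro f hf M hM
    apply finsum_eq_sum_of_support_subset
    intro r hr
    rw [Function.mem_support] at hr
    have : ¬ N ≤ r := fun h => hr (hf r h)
    simp only [Finset.coe_range, Set.mem_Iio]
    omega
  rw [← hlam a, ← hlamt a, hsub _ h0 (N + 1) (by omega),
    hsub _ (fun r hr => h0 (r + 1) (by omega)) N le_rfl, Finset.sum_range_succ', add_comm]

theorem IsComposition.tail_type {n : ℕ} {mu lam lamt : ℕ → ℕ} {A : ℕ → Multiset ℕ}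
    (hlam : IsComposition n lam) (hA : RowsOfShape mu A)
    (h : ∀ a, lam a = (A 0).count a + lamt a) : IsComposition (n - mu 0) lamt := by
  obtain ⟨N, hN, hs⟩ := hlam
  refine ⟨N, fun r hr => ?_, ?_⟩
  · have := h r
    rw [hN r hr] at this
    omega
  · have h1 : ∑ a ∈ Finset.range N, (A 0).count a = (A 0).card := by
      apply Multiset.sum_count_eq_card
      intro a ha
      rw [Finset.mem_range]
      by_contra hlt
      push Not at hlt
      have h2 := h a
      rw [hN a hlt] at h2
      have := Multiset.count_pos.mpr ha
      omega
    rw [hA] at h1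
    have h3 : cumSum lam N = mu 0 + cumSum lamt N := by
      simp only [cumSum, h, Finset.sum_add_distrib, h1]
    omega

/-- The permutations that put the multiset `A0` in the first row, and are of minimal length in
their coset of the symmetric group on the remaining positions. -/
def headReps (n : ℕ) (mu lam : ℕ → ℕ) (A0 : Multiset ℕ) : Finset (Equiv.Perm (Fin n)) :=
  Finset.univ.filter fun w =>
    (∀ a, (Finset.univ.filter
      (fun p : Fin n => rowOf lam p = a ∧ rowOf mu (w p) = 0)).card = A0.count a) ∧
    StrictMono fun k => w⁻¹ (tailEmb n (mu 0) k)

section Factor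

variable {n : ℕ} {mu lam lamt : ℕ → ℕ} {A : ℕ → Multiset ℕ}

theorem rowOf_tailHom_eq_zero_iff (hmu : IsComposition n mu) (v : Equiv.Perm (Fin (n - mu 0)))
    (x : Fin n) : rowOf mu (tailHom n (mu 0) v x) = 0 ↔ rowOf mu x = 0 := by
  rw [rowOf_eq_zero_iff hmu (Fin.isLt _), rowOf_eq_zero_iff hmu (Fin.isLt _)]
  rcases lt_or_ge (x : ℕ) (mu 0) with hx | hx
  · rw [tailHom_of_lt _ _ hx]
  · obtain ⟨k, rfl⟩ := exists_tailEmb x hx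
    simp

theorem card_rowOf_tailHom_mul (hmu : IsComposition n mu) (w : Equiv.Perm (Fin n))
    (v : Equiv.Perm (Fin (n - mu 0))) (a r : ℕ) :
    (Finset.univ.filter (fun p : Fin n =>
      rowOf lam p = a ∧ rowOf mu ((tailHom n (mu 0) v * w) p) = r + 1)).card =
    (Finset.univ.filter (fun k : Fin (n - mu 0) =>
      rowOf lam (w⁻¹ (tailEmb n (mu 0) k)) = a ∧ rowOf (fun s => mu (s + 1)) (v k) = r)).card := by
  have h1 := card_filter_tailEmb (m := mu 0) (fun x : Fin n =>
    rowOf lam (w⁻¹ x) = a ∧ rowOf mu (tailHom n (mu 0) v x) = r + 1)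
  simp only [tailHom_tailEmb, tailEmb_val, rowOf_tailEmb hmu, add_left_inj] at h1
  rw [h1, ← card_filter_comp_perm w (fun x : Fin n =>
    (rowOf lam (w⁻¹ x) = a ∧ rowOf mu (tailHom n (mu 0) v x) = r + 1) ∧ mu 0 ≤ x)]
  refine congrArg Finset.card (Finset.filter_congr fun p _ => ?_)
  have h2 : rowOf mu (tailHom n (mu 0) v (w p)) = r + 1 → mu 0 ≤ w p := by
    intro h
    by_contra hlt
    push Not at hlt
    have := (rowOf_tailHom_eq_zero_iff hmu v (w p)).mpr
      ((rowOf_eq_zero_iff hmu (Fin.isLt _)).mpr hlt)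
    omega
  simp only [Equiv.Perm.mul_apply, Equiv.Perm.inv_def, Equiv.symm_apply_apply]
  tauto

theorem rowOf_of_mem_headReps (hmu : IsComposition n mu) (hlam : IsComposition n lam)
    (hA : RowsOfShape mu A) (h : ∀ a, lam a = (A 0).count a + lamt a)
    {w : Equiv.Perm (Fin n)} (hw : w ∈ headReps n mu lam (A 0)) (k : Fin (n - mu 0)) :
    rowOf lam (w⁻¹ (tailEmb n (mu 0) k)) = rowOf lamt k := by
  simp only [headReps, Finset.mem_filter, Finset.mem_univ, true_and] at hw
  have hlamt := hlam.tail_type hA h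
  refine congrFun (monotone_eq_of_card_fiber
    (f := fun k => rowOf lam (w⁻¹ (tailEmb n (mu 0) k))) (g := fun k => rowOf lamt k) ?_ ?_ ?_) k
  · exact fun a b hab => hlam.rowOf_mono (Fin.le_def.mp (hw.2.monotone hab)) (Fin.isLt _)
  · exact fun a b hab => hlamt.rowOf_mono (Fin.le_def.mp hab) b.2
  · intro a
    rw [hlamt.card_rowOf, card_filter_tailEmb (fun x : Fin n => rowOf lam (w⁻¹ x) = a),
      ← card_filter_comp_perm w (fun x : Fin n => rowOf lam (w⁻¹ x) = a ∧ mu 0 ≤ x)]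
    have h1 := hw.1 a
    have h2 := hlam.card_rowOf a
    rw [← Finset.card_filter_add_card_filter_not (s := Finset.univ.filter _)
      (fun p : Fin n => rowOf mu (w p) = 0), Finset.filter_filter, Finset.filter_filter, h1,
      h a, add_right_inj] at h2
    rw [← h2]
    refine congrArg Finset.card (Finset.filter_congr fun p _ => ?_)
    rw [rowOf_eq_zero_iff hmu (Fin.isLt _), not_lt]
    simp

theorem tailHom_mul_mem_doubleCoset_iff (hmu : IsComposition n mu) (hlam : IsComposition n lam)
    (hA : RowsOfShape mu A) (h : ∀ a, lam a = (A 0).count a + lamt a)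
    {d : Equiv.Perm (Fin n)} (hd : Is1A mu lam A d) {dt : Equiv.Perm (Fin (n - mu 0))}
    (hdt : Is1A (fun s => mu (s + 1)) lamt (fun s => A (s + 1)) dt)
    {w : Equiv.Perm (Fin n)} (v : Equiv.Perm (Fin (n - mu 0)))
    (hw : StrictMono fun k => w⁻¹ (tailEmb n (mu 0) k)) :
    tailHom n (mu 0) v * w ∈ doubleCoset lam mu d ↔
      w ∈ headReps n mu lam (A 0) ∧ v ∈ doubleCoset lamt (fun s => mu (s + 1)) dt := by
  rw [mem_doubleCoset_iff hmu hA hd, mem_doubleCoset_iff hmu.tail (fun r => hA (r + 1)) hdt]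
  have hhead : w ∈ headReps n mu lam (A 0) ↔ ∀ a, (Finset.univ.filter (fun p : Fin n =>
      rowOf lam p = a ∧ rowOf mu ((tailHom n (mu 0) v * w) p) = 0)).card = (A 0).count a := by
    simp only [headReps, Finset.mem_filter, Finset.mem_univ, true_and, hw, and_true,
      Equiv.Perm.mul_apply, rowOf_tailHom_eq_zero_iff hmu]
  constructor
  · intro hz
    have hw' := hhead.mpr fun a => hz a 0
    refine ⟨hw', fun a r => ?_⟩
    rw [← hz a (r + 1), card_rowOf_tailHom_mul hmu]
    simp only [rowOf_of_mem_headReps hmu hlam hA h hw']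
  · rintro ⟨hw', hv⟩ a r
    rcases r with _ | r
    · exact hhead.mp hw' a
    · rw [← hv a r, card_rowOf_tailHom_mul hmu]
      simp only [rowOf_of_mem_headReps hmu hlam hA h hw']

theorem existsUnique_strictMono_comp {k : ℕ} {β : Type*} [LinearOrder β] {f : Fin k → β}
    (hf : Function.Injective f) : ∃! v : Equiv.Perm (Fin k), StrictMono (f ∘ v) := by
  have := existsUnique_block_sort (ρ := fun _ : Fin k => 0) monotone_const hf
  simpa [StrictMono] using this

variable {F : Type*} [Field F] {H : Type*} [Ring H] [Algebra F H]
  {H' : Type*} [Ring H'] [Algebra F H'] {q : F}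
  {T : Equiv.Perm (Fin n) → H} {T' : Equiv.Perm (Fin (n - mu 0)) → H'}

theorem XPhi_eq_mul (hT : IsHeckeBasis q T) (j : H' →ₗ[F] H)
    (hj : ∀ w, j (T' w) = T (tailHom n (mu 0) w))
    (hmu : IsComposition n mu) (hlam : IsComposition n lam)
    (hA : RowsOfShape mu A) (h : ∀ a, lam a = (A 0).count a + lamt a)
    {d : Equiv.Perm (Fin n)} (hd : Is1A mu lam A d) {dt : Equiv.Perm (Fin (n - mu 0))}
    (hdt : Is1A (fun s => mu (s + 1)) lamt (fun s => A (s + 1)) dt) :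
    XPhi T lam mu d =
      (∑ w ∈ headReps n mu lam (A 0), T w) * j (XPhi T' lamt (fun s => mu (s + 1)) dt) := by
  have hinj : ∀ z : Equiv.Perm (Fin n),
      Function.Injective fun k => z⁻¹ (tailEmb n (mu 0) k) := fun z =>
    (z⁻¹).injective.comp (tailEmb n (mu 0)).injective
  have hmono : ∀ w ∈ headReps n mu lam (A 0),
      StrictMono fun k => w⁻¹ (tailEmb n (mu 0) k) := fun w hw => (Finset.mem_filter.mp hw).2.2
  rw [XPhi, XPhi, map_sum, Finset.sum_mul_sum, ← Finset.sum_product']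
  symm
  refine Finset.sum_bij (fun x _ => tailHom n (mu 0) x.2 * x.1) ?_ ?_ ?_ ?_
  · rintro ⟨w, v⟩ hx
    simp only [Finset.mem_product, Finset.mem_filter, Finset.mem_univ, true_and] at hx ⊢
    exact (tailHom_mul_mem_doubleCoset_iff hmu hlam hA h hd hdt v (hmono w hx.1)).mpr hx
  · rintro ⟨w, v⟩ hx ⟨w', v'⟩ hx' he
    simp only [Finset.mem_product, Finset.mem_filter, Finset.mem_univ, true_and] at hx hx' he
    have hv : v = v' := by
      refine (existsUnique_strictMono_comp (hinj (tailHom n (mu 0) v * w))).unique ?_ ?_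
      · convert hmono w hx.1 using 2 with k
        simp only [Function.comp, mul_inv_rev, Equiv.Perm.mul_apply, tailHom_inv_tailEmb]
        simp
      · rw [he]
        convert hmono w' hx'.1 using 2 with k
        simp only [Function.comp, mul_inv_rev, Equiv.Perm.mul_apply, tailHom_inv_tailEmb]
        simp
    subst hv
    simpa using he
  · intro z hz
    simp only [Finset.mem_filter, Finset.mem_univ, true_and] at hz
    obtain ⟨v, hv, -⟩ := existsUnique_strictMono_comp (hinj z)
    have hw : StrictMono fun k => ((tailHom n (mu 0) v)⁻¹ * z)⁻¹ (tailEmb n (mu 0) k) := by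
      convert hv using 2 with k
      simp only [Function.comp, mul_inv_rev, Equiv.Perm.mul_apply, inv_inv, tailHom_tailEmb]
    have e : tailHom n (mu 0) v * ((tailHom n (mu 0) v)⁻¹ * z) = z := by group
    have := (tailHom_mul_mem_doubleCoset_iff hmu hlam hA h hd hdt v hw).mp (e.symm ▸ hz)
    exact ⟨((tailHom n (mu 0) v)⁻¹ * z, v), by simpa using this, e⟩
  · rintro ⟨w, v⟩ hx
    simp only [Finset.mem_product, Finset.mem_filter, Finset.mem_univ, true_and] at hx
    simp only [hj]
    apply hT.mul_of_lengthAdditive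
    intro x y hxy hlt
    obtain ⟨a, b, rfl, rfl, hab, -⟩ := exists_of_tailHom_lt hxy hlt
    exact hmono w hx.1 hab

end Factor

section ColumnReading

variable {n : ℕ} {mu : ℕ → ℕ}

theorem colIdx_lt (hmu : IsComposition n mu) {p : ℕ} (hp : p < n) :
    colIdx mu p < mu (rowOf mu p) := by
  have h := hmu.rowOf_spec hp
  rw [cumSum_succ] at h
  unfold colIdx
  omega

theorem eq_of_colIdx_eq_of_rowOf_eq (hmu : IsComposition n mu) {p p' : Fin n}
    (hc : colIdx mu p = colIdx mu p') (hr : rowOf mu p = rowOf mu p') : p = p' := by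
  have h := hmu.rowOf_spec p.2
  have h' := hmu.rowOf_spec p'.2
  unfold colIdx at hc
  rw [hr] at h hc
  ext
  omega

theorem lt_conjP_iff (hmu : IsPartition n mu) (r c : ℕ) : r < conjP mu c ↔ c < mu r := by
  obtain ⟨⟨N, hN, -⟩, hanti⟩ := hmu
  have hne : {r | mu r ≤ c}.Nonempty := ⟨N, by simp [hN N le_rfl]⟩
  constructor
  · intro h
    by_contra hlt
    push Not at hlt
    exact absurd (Nat.sInf_le (s := {r | mu r ≤ c}) hlt) h.not_ge
  · intro h
    by_contra hlt
    push Not at hlt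
    have h1 : mu (conjP mu c) ≤ c := Nat.sInf_mem hne
    exact absurd ((hanti hlt).trans h1) h.not_ge

theorem card_colIdx (hmu : IsPartition n mu) (c : ℕ) :
    (Finset.univ.filter (fun p : Fin n => colIdx mu p = c)).card = conjP mu c := by
  rw [← Finset.card_range (conjP mu c)]
  refine Finset.card_bij (fun p _ => rowOf mu p) ?_ ?_ ?_
  · intro p hp
    simp only [Finset.mem_filter, Finset.mem_univ, true_and] at hp
    rw [Finset.mem_range, lt_conjP_iff hmu, ← hp]
    exact colIdx_lt hmu.1 p.2
  · intro p hp p' hp' he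
    simp only [Finset.mem_filter, Finset.mem_univ, true_and] at hp hp'
    exact eq_of_colIdx_eq_of_rowOf_eq hmu.1 (hp.trans hp'.symm) he
  · intro r hr
    rw [Finset.mem_range, lt_conjP_iff hmu] at hr
    have hle := hmu.1.cumSum_le (r + 1)
    have hs := cumSum_succ mu r
    have hrow : rowOf mu (cumSum mu r + c) = r := rowOf_eq (by omega) (by omega)
    refine ⟨⟨cumSum mu r + c, by omega⟩, Finset.mem_filter.mpr ⟨Finset.mem_univ _, ?_⟩, hrow⟩
    change colIdx mu (cumSum mu r + c) = c
    rw [colIdx, hrow]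
    omega

theorem cumSum_conjP (hmu : IsPartition n mu) (c : ℕ) :
    cumSum (conjP mu) c = (Finset.univ.filter (fun p : Fin n => colIdx mu p < c)).card := by
  induction c with
  | zero => simp [cumSum]
  | succ c ih =>
    rw [cumSum_succ, ih, ← card_colIdx hmu, ← Finset.card_union_of_disjoint]
    · refine congrArg Finset.card ?_
      ext p
      simp only [Finset.mem_union, Finset.mem_filter, Finset.mem_univ, true_and]
      omega
    · rw [Finset.disjoint_filter]
      intro p _ h
      omega

theorem IsPartition.conjP_isComposition (hmu : IsPartition n mu) : IsComposition n (conjP mu) := by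
  refine ⟨mu 0, fun r hr => ?_, ?_⟩
  · by_contra h
    have := (lt_conjP_iff hmu 0 r).mp (Nat.pos_of_ne_zero h)
    omega
  · rw [cumSum_conjP hmu, Finset.filter_true_of_mem, Finset.card_univ, Fintype.card_fin]
    intro p _
    exact (colIdx_lt hmu.1 p.2).trans_le (hmu.2 (Nat.zero_le _))

theorem IsWmu.lt_iff (hmu : IsComposition n mu) {w : Equiv.Perm (Fin n)} (hw : IsWmu mu w)
    (p p' : Fin n) : w p < w p' ↔ colIdx mu p < colIdx mu p' ∨
      (colIdx mu p = colIdx mu p' ∧ rowOf mu p < rowOf mu p') := by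
  have key : ∀ p p' : Fin n, (colIdx mu p < colIdx mu p' ∨
      (colIdx mu p = colIdx mu p' ∧ rowOf mu p < rowOf mu p')) → w p < w p' := by
    intro p p' h
    rw [Fin.lt_def, hw p, hw p']
    apply Finset.card_lt_card
    rw [Finset.ssubset_iff_of_subset]
    · refine ⟨p, by simpa using h, by simp⟩
    · intro x hx
      simp only [Finset.mem_filter, Finset.mem_univ, true_and] at hx ⊢
      omega
  refine ⟨fun h => ?_, key p p'⟩
  by_contra hcon
  rcases eq_or_ne p p' with rfl | hne
  · exact lt_irrefl _ h
  · refine absurd (key p' p ?_) h.le.not_gt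
    by_contra h2
    exact hne (eq_of_colIdx_eq_of_rowOf_eq hmu (by omega) (by omega))

theorem IsWmu.rowOf_conjP (hmu : IsPartition n mu) {w : Equiv.Perm (Fin n)} (hw : IsWmu mu w)
    (p : Fin n) : rowOf (conjP mu) (w p) = colIdx mu p := by
  apply rowOf_eq
  · rw [cumSum_conjP hmu, hw p]
    apply Finset.card_le_card
    intro x hx
    simp only [Finset.mem_filter, Finset.mem_univ, true_and] at hx ⊢
    exact Or.inl hx
  · rw [cumSum_conjP hmu, hw p]
    apply Finset.card_lt_card
    rw [Finset.ssubset_iff_of_subset]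
    · exact ⟨p, by simp, by simp⟩
    · intro x hx
      simp only [Finset.mem_filter, Finset.mem_univ, true_and] at hx ⊢
      omega

theorem colIdx_tailEmb (hmu : IsComposition n mu) (k : Fin (n - mu 0)) :
    colIdx mu (mu 0 + k) = colIdx (fun s => mu (s + 1)) k := by
  rw [colIdx, rowOf_tailEmb hmu, cumSum_succ', colIdx]
  omega

theorem IsWmu.tailEmb_lt_iff (hmu : IsComposition n mu) {w : Equiv.Perm (Fin n)}
    (hw : IsWmu mu w) {wt : Equiv.Perm (Fin (n - mu 0))}
    (hwt : IsWmu (fun s => mu (s + 1)) wt) (a b : Fin (n - mu 0)) :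
    w (tailEmb n (mu 0) a) < w (tailEmb n (mu 0) b) ↔ wt a < wt b := by
  rw [hw.lt_iff hmu, hwt.lt_iff hmu.tail]
  simp only [tailEmb_val, colIdx_tailEmb hmu, rowOf_tailEmb hmu]
  omega

theorem youngW_mul {lam : ℕ → ℕ} {v w : Equiv.Perm (Fin n)} (hv : v ∈ youngW lam)
    (hw : w ∈ youngW lam) : v * w ∈ youngW lam := fun p => (hv (w p)).trans (hw p)

/-- An inversion of an element of a Young subgroup lies within one block. -/
theorem rowOf_eq_of_youngW {lam : ℕ → ℕ} (hlam : IsComposition n lam) {v : Equiv.Perm (Fin n)}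
    (hv : v ∈ youngW lam) {i j : Fin n} (hij : i < j) (h : v j < v i) :
    rowOf lam i = rowOf lam j := by
  apply le_antisymm
  · exact hlam.rowOf_mono (Fin.le_def.mp hij.le) j.2
  · rw [← hv i, ← hv j]
    exact hlam.rowOf_mono (Fin.le_def.mp h.le) (Fin.isLt _)

variable {wmu : Equiv.Perm (Fin n)} {wt : Equiv.Perm (Fin (n - mu 0))}

theorem lengthAdditive_tailHom_wmu (hmu : IsComposition n mu) (hw : IsWmu mu wmu)
    (hwt : IsWmu (fun s => mu (s + 1)) wt) :
    LengthAdditive (tailHom n (mu 0) wt) (wmu * (tailHom n (mu 0) wt)⁻¹) := by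
  intro i j hij hlt
  by_contra hcon
  have hne : (tailHom n (mu 0) wt)⁻¹ i ≠ (tailHom n (mu 0) wt)⁻¹ j :=
    (tailHom n (mu 0) wt)⁻¹.injective.ne hij.ne
  have h2 := lt_of_le_of_ne (not_lt.mp hcon) hne.symm
  rw [← map_inv] at h2
  obtain ⟨a, b, rfl, rfl, hab, -⟩ := exists_of_tailHom_lt hij h2
  simp only [Equiv.Perm.mul_apply, tailHom_inv_tailEmb, hw.tailEmb_lt_iff hmu hwt] at hlt
  simp only [Equiv.Perm.inv_def, Equiv.apply_symm_apply] at hlt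
  exact absurd hab hlt.le.not_gt

theorem lengthAdditive_wmu_youngW (hmu : IsPartition n mu) (hw : IsWmu mu wmu)
    (hwt : IsWmu (fun s => mu (s + 1)) wt) {x : Equiv.Perm (Fin n)}
    (hx : x ∈ youngW (conjP mu)) : LengthAdditive (wmu * (tailHom n (mu 0) wt)⁻¹) x := by
  intro i j hij hlt
  have hrow := rowOf_eq_of_youngW hmu.conjP_isComposition hx hij hlt
  obtain ⟨p, rfl⟩ := wmu.surjective i
  obtain ⟨p', rfl⟩ := wmu.surjective j
  rw [hw.rowOf_conjP hmu, hw.rowOf_conjP hmu] at hrow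
  have hr : rowOf mu p < rowOf mu p' := by
    rcases (hw.lt_iff hmu.1 p p').mp hij with h | h
    · omega
    · exact h.2
  have hp' : mu 0 ≤ p' := by
    by_contra hlt'
    push Not at hlt'
    have := (rowOf_eq_zero_iff hmu.1 p'.2).mpr hlt'
    omega
  obtain ⟨b, rfl⟩ := exists_tailEmb p' hp'
  simp only [mul_inv_rev, Equiv.Perm.mul_apply, Equiv.Perm.inv_def, Equiv.symm_symm,
    Equiv.symm_apply_apply, tailHom_tailEmb]
  rcases lt_or_ge (p : ℕ) (mu 0) with hp | hp
  · rw [tailHom_of_lt _ _ hp, Fin.lt_def, tailEmb_val]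
    omega
  · obtain ⟨a, rfl⟩ := exists_tailEmb p hp
    rw [tailHom_tailEmb, tailEmb_lt_tailEmb, ← hw.tailEmb_lt_iff hmu.1 hwt]
    exact hij

theorem rowOf_conjP_wmu_tailEmb (hmu : IsPartition n mu) (hw : IsWmu mu wmu)
    (hwt : IsWmu (fun s => mu (s + 1)) wt) (k : Fin (n - mu 0)) :
    rowOf (conjP mu) ((wmu * (tailHom n (mu 0) wt)⁻¹) (tailEmb n (mu 0) k)) =
      rowOf (conjP fun s => mu (s + 1)) k := by
  rw [Equiv.Perm.mul_apply, tailHom_inv_tailEmb, hw.rowOf_conjP hmu, tailEmb_val,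
    colIdx_tailEmb hmu.1, ← hwt.rowOf_conjP hmu.tail]
  simp

theorem conj_tailHom_mem_youngW (hmu : IsPartition n mu) (hw : IsWmu mu wmu)
    (hwt : IsWmu (fun s => mu (s + 1)) wt) {v : Equiv.Perm (Fin (n - mu 0))}
    (hv : v ∈ youngW (conjP fun s => mu (s + 1))) :
    (wmu * (tailHom n (mu 0) wt)⁻¹) * tailHom n (mu 0) v * (wmu * (tailHom n (mu 0) wt)⁻¹)⁻¹ ∈
      youngW (conjP mu) := by
  have h1 := rowOf_conjP_wmu_tailEmb hmu hw hwt
  generalize wmu * (tailHom n (mu 0) wt)⁻¹ = u at h1 ⊢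
  intro p
  obtain ⟨x, rfl⟩ := u.surjective p
  simp only [Equiv.Perm.mul_apply, Equiv.Perm.inv_def, Equiv.symm_apply_apply]
  rcases lt_or_ge (x : ℕ) (mu 0) with hx | hx
  · rw [tailHom_of_lt _ _ hx]
  · obtain ⟨k, rfl⟩ := exists_tailEmb x hx
    rw [tailHom_tailEmb, h1, h1]
    exact hv k

variable {F : Type*} [Field F] {H : Type*} [Ring H] [Algebra F H]
  {H' : Type*} [Ring H'] [Algebra F H'] {q : F}
  {T : Equiv.Perm (Fin n) → H} {T' : Equiv.Perm (Fin (n - mu 0)) → H'}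

theorem exists_wmu_mul_yElt_eq (hT : IsHeckeBasis q T) (hq : q ≠ 0) (j : H' →ₗ[F] H)
    (hj : ∀ w, j (T' w) = T (tailHom n (mu 0) w)) (hmu : IsPartition n mu) (hw : IsWmu mu wmu)
    (hwt : IsWmu (fun s => mu (s + 1)) wt) :
    ∃ h : H, T wmu * yElt q T (conjP mu) =
      j (T' wt) * j (yElt q T' (conjP fun s => mu (s + 1))) * h := by
  set u := wmu * (tailHom n (mu 0) wt)⁻¹ with hu
  set c := (-q)⁻¹ with hc
  have hc0 : c ≠ 0 := inv_ne_zero (neg_ne_zero.mpr hq)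
  have hwu : T wmu = j (T' wt) * T u := by
    rw [hj, hT.mul_of_lengthAdditive (lengthAdditive_tailHom_wmu hmu.1 hw hwt)]
    simp
  -- the coset of the column stabilizer containing `u`
  let X : Set (Equiv.Perm (Fin n)) := {z | z * u⁻¹ ∈ youngW (conjP mu)}
  have hρ : Monotone fun k : Fin (n - mu 0) => rowOf (conjP fun s => mu (s + 1)) k :=
    fun a b hab => hmu.tail.conjP_isComposition.rowOf_mono (Fin.le_def.mp hab) b.2
  -- representatives increasing along the blocks
  let R : Finset (Equiv.Perm (Fin n)) := Finset.univ.filter fun z => z ∈ X ∧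
    ∀ a b : Fin (n - mu 0), a < b → rowOf (conjP fun s => mu (s + 1)) a =
      rowOf (conjP fun s => mu (s + 1)) b → z (tailEmb n (mu 0) a) < z (tailEmb n (mu 0) b)
  have hX : ∀ z ∈ X, ∀ v ∈ youngW (conjP fun s => mu (s + 1)), z * tailHom n (mu 0) v ∈ X := by
    intro z hz v hv
    have := youngW_mul hz (conj_tailHom_mem_youngW hmu hw hwt hv)
    rw [← hu] at this
    change z * tailHom n (mu 0) v * u⁻¹ ∈ youngW (conjP mu)
    convert this using 1
    group
  have h1 : c ^ permLength u • (T u * yElt q T (conjP mu)) =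
      ∑ z ∈ Finset.univ.filter (· ∈ X), c ^ permLength z • T z := by
    rw [yElt, Finset.mul_sum, Finset.smul_sum]
    refine Finset.sum_bij (fun w _ => w * u) ?_ ?_ ?_ ?_
    · intro w hw'
      simpa [X] using hw'
    · intro w _ w' _ he
      exact mul_right_cancel he
    · intro z hz
      exact ⟨z * u⁻¹, by simpa [X] using hz, by simp⟩
    · intro w hw'
      simp only [Finset.mem_filter, Finset.mem_univ, true_and] at hw'
      have hadd := lengthAdditive_wmu_youngW hmu hw hwt hw'
      rw [mul_smul_comm, hT.mul_of_lengthAdditive hadd, hadd.permLength_mul, smul_smul, pow_add]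
  have h2 : ∑ z ∈ Finset.univ.filter (· ∈ X), c ^ permLength z • T z =
      j (yElt q T' (conjP fun s => mu (s + 1))) * ∑ z ∈ R, c ^ permLength z • T z := by
    rw [yElt, map_sum, Finset.sum_mul_sum, ← Finset.sum_product']
    symm
    have hR : ∀ z v, v ∈ youngW (conjP fun s => mu (s + 1)) → z ∈ R →
        ((∀ p : Fin (n - mu 0), rowOf (conjP fun s => mu (s + 1)) (v⁻¹ p) =
          rowOf (conjP fun s => mu (s + 1)) p) ∧
        ∀ p p' : Fin (n - mu 0), p < p' → rowOf (conjP fun s => mu (s + 1)) p =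
          rowOf (conjP fun s => mu (s + 1)) p' →
          (z * tailHom n (mu 0) v) (tailEmb n (mu 0) (v⁻¹ p)) <
            (z * tailHom n (mu 0) v) (tailEmb n (mu 0) (v⁻¹ p'))) := by
      intro z v hv hz
      refine ⟨youngW_inv hv, fun p p' hp he => ?_⟩
      simp only [Equiv.Perm.mul_apply, tailHom_tailEmb, Equiv.Perm.inv_def,
        Equiv.apply_symm_apply]
      exact (Finset.mem_filter.mp hz).2.2 p p' hp he
    refine Finset.sum_bij (fun x _ => x.2 * tailHom n (mu 0) x.1) ?_ ?_ ?_ ?_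
    · rintro ⟨v, z⟩ hx
      simp only [Finset.mem_product, Finset.mem_filter, Finset.mem_univ, true_and] at hx ⊢
      exact hX z (Finset.mem_filter.mp hx.2).2.1 v hx.1
    · rintro ⟨v, z⟩ hx ⟨v', z'⟩ hx' he
      simp only [Finset.mem_product, Finset.mem_filter, Finset.mem_univ, true_and] at hx hx' he
      have hv : v⁻¹ = v'⁻¹ := by
        refine (existsUnique_block_sort hρ (f := fun k =>
          (z * tailHom n (mu 0) v) (tailEmb n (mu 0) k))
          ((Equiv.injective _).comp (tailEmb n (mu 0)).injective)).unique
          (hR z v hx.1 hx.2) ?_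
        rw [he]
        exact hR z' v' hx'.1 hx'.2
      obtain rfl := inv_injective hv
      simpa using he
    · intro z hz
      simp only [Finset.mem_filter, Finset.mem_univ, true_and] at hz
      obtain ⟨v, ⟨hv1, hv2⟩, -⟩ := existsUnique_block_sort hρ (f := fun k =>
          z (tailEmb n (mu 0) k)) (z.injective.comp (tailEmb n (mu 0)).injective)
      have hvy : v ∈ youngW (conjP fun s => mu (s + 1)) := hv1
      refine ⟨(v⁻¹, z * tailHom n (mu 0) v), ?_, by simp⟩
      simp only [Finset.mem_product, Finset.mem_filter, Finset.mem_univ, true_and, R]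
      refine ⟨youngW_inv hvy, hX z hz v hvy, ?_⟩
      intro a b hab he
      simpa using hv2 a b hab he
    · rintro ⟨v, z⟩ hx
      simp only [Finset.mem_product, Finset.mem_filter, Finset.mem_univ, true_and] at hx
      have hadd : LengthAdditive (tailHom n (mu 0) v) z := by
        intro x y hxy hlt
        by_contra hcon
        have hne : (tailHom n (mu 0) v)⁻¹ x ≠ (tailHom n (mu 0) v)⁻¹ y :=
          (tailHom n (mu 0) v)⁻¹.injective.ne hxy.ne
        have h3 := lt_of_le_of_ne (not_lt.mp hcon) hne.symm
        rw [← map_inv] at h3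
        obtain ⟨a, b, rfl, rfl, hab, hba⟩ := exists_of_tailHom_lt hxy h3
        have := (Finset.mem_filter.mp hx.2).2.2 a b hab
          (rowOf_eq_of_youngW hmu.tail.conjP_isComposition (youngW_inv hx.1) hab hba)
        exact absurd this hlt.le.not_gt
      simp only [map_smul, hj]
      rw [smul_mul_smul_comm, hT.mul_of_lengthAdditive hadd, hadd.permLength_mul,
        permLength_tailHom, pow_add]
  refine ⟨(c ^ permLength u)⁻¹ • ∑ z ∈ R, c ^ permLength z • T z, ?_⟩
  rw [mul_smul_comm, mul_assoc, ← h2, ← h1, hwu, mul_smul_comm, smul_smul,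
    inv_mul_cancel₀ (pow_ne_zero _ hc0), one_smul, mul_assoc]

end ColumnReading

/-- Proposition: removing the top row preserves relations.
`μ ⊢ n`, `λ ⊨ n`; `A_1,…,A_r` row-standard `μ`-tableaux of type `λ` identical in
row 1; `μ̃ = (μ_2, μ_3, …)`; `Ã_i` obtained by deleting row 1, of common type `λ̃`.
If `∑ c_i φ̂_{Ã_i} = 0` (homomorphisms `S^{μ̃} → M^{λ̃}` over `H_{n-μ_1}`) then
`∑ c_i φ̂_{A_i} = 0` (homomorphisms `S^μ → M^λ` over `H_n`). -/
theorem row_removal_top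
    {F : Type*} [Field F] {H : Type*} [Ring H] [Algebra F H]
    {H' : Type*} [Ring H'] [Algebra F H']
    {n : ℕ} (q : F) (hq : q ≠ 0)
    (mu lam : ℕ → ℕ) (hmu : IsPartition n mu) (hlam : IsComposition n lam)
    (T : Equiv.Perm (Fin n) → H) (hT : IsHeckeBasis q T)
    (T' : Equiv.Perm (Fin (n - mu 0)) → H') (hT' : IsHeckeBasis q T')
    (r : ℕ) (A : Fin r → ℕ → Multiset ℕ) (c : Fin r → F)
    (hshape : ∀ i, RowsOfShape mu (A i)) (htype : ∀ i, HasType (A i) lam)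
    (hrow1 : ∀ i j, A i 0 = A j 0)
    (lamt : ℕ → ℕ) (hlamt : ∀ i, HasType (fun s => A i (s+1)) lamt)
    (d : Fin r → Equiv.Perm (Fin n)) (hd : ∀ i, Is1A mu lam (A i) (d i))
    (dt : Fin r → Equiv.Perm (Fin (n - mu 0)))
    (hdt : ∀ i, Is1A (fun s => mu (s+1)) lamt (fun s => A i (s+1)) (dt i))
    (wmu : Equiv.Perm (Fin n)) (hwmu : IsWmu mu wmu)
    (wmut : Equiv.Perm (Fin (n - mu 0))) (hwmut : IsWmu (fun s => mu (s+1)) wmut)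
    -- homomorphism data over `H_{n-μ_1}`
    (Mt : Submodule H'ᵐᵒᵖ H')
    (hMt : Mt = Submodule.span H'ᵐᵒᵖ {xElt T' (fun s => mu (s+1))})
    (St : Submodule H'ᵐᵒᵖ H')
    (hSt : St = Submodule.span H'ᵐᵒᵖ
      {xElt T' (fun s => mu (s+1)) * (T' wmut * yElt q T' (conjP (fun s => mu (s+1))))})
    (hlet : St ≤ Mt) (hxt : xElt T' (fun s => mu (s+1)) ∈ Mt)
    (ψ : Fin r → (Mt →ₗ[H'ᵐᵒᵖ] H'))
    (hψ : ∀ i, ψ i ⟨xElt T' (fun s => mu (s+1)), hxt⟩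
      = XPhi T' lamt (fun s => mu (s+1)) (dt i))
    (hyp : ∀ (z : H') (hz : z ∈ St), ∑ i, c i • ψ i ⟨z, hlet hz⟩ = 0)
    -- homomorphism data over `H_n`
    (Mmu : Submodule Hᵐᵒᵖ H) (hMmu : Mmu = Submodule.span Hᵐᵒᵖ {xElt T mu})
    (Smu : Submodule Hᵐᵒᵖ H)
    (hSmu : Smu = Submodule.span Hᵐᵒᵖ {xElt T mu * (T wmu * yElt q T (conjP mu))})
    (hle : Smu ≤ Mmu) (hx : xElt T mu ∈ Mmu)
    (φ : Fin r → (Mmu →ₗ[Hᵐᵒᵖ] H))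
    (hφ : ∀ i, φ i ⟨xElt T mu, hx⟩ = XPhi T lam mu (d i)) :
    ∀ (z : H) (hz : z ∈ Smu), ∑ i, c i • φ i ⟨z, hle hz⟩ = 0 := by
  obtain ⟨j, hj, hjm⟩ := exists_heckeTail hT hT'
  obtain ⟨h₀, hh₀⟩ := exists_wmu_mul_yElt_eq hT hq j hj hmu hwmu hwmut
  obtain ⟨A0, hA0⟩ : ∃ A0, ∀ i, A i 0 = A0 := by
    rcases isEmpty_or_nonempty (Fin r) with he | ⟨⟨i₀⟩⟩
    · exact ⟨0, fun i => he.elim i⟩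
    · exact ⟨A i₀ 0, fun i => hrow1 i i₀⟩
  have hX : ∀ i, XPhi T lam mu (d i) = (∑ w ∈ headReps n mu lam A0, T w) *
      j (XPhi T' lamt (fun s => mu (s + 1)) (dt i)) := by
    intro i
    rw [← hA0 i]
    exact XPhi_eq_mul hT j hj hmu.1 hlam (hshape i)
      (HasType.eq_head_add hmu.1 (hshape i) (htype i) (hlamt i)) (hd i) (hdt i)
  have hφ' : ∀ i (a : H) (ha : xElt T mu * a ∈ Mmu),
      φ i ⟨xElt T mu * a, ha⟩ = XPhi T lam mu (d i) * a := by
    intro i a ha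
    have := (φ i).map_smul (MulOpposite.op a) ⟨xElt T mu, hx⟩
    rw [hφ i] at this
    exact this
  have hψ' : ∀ i (a : H') (ha : xElt T' (fun s => mu (s + 1)) * a ∈ Mt),
      ψ i ⟨xElt T' (fun s => mu (s + 1)) * a, ha⟩ =
        XPhi T' lamt (fun s => mu (s + 1)) (dt i) * a := by
    intro i a ha
    have := (ψ i).map_smul (MulOpposite.op a) ⟨xElt T' (fun s => mu (s + 1)), hxt⟩
    rw [hψ i] at this
    exact this
  have hzero : ∑ i, c i • (XPhi T' lamt (fun s => mu (s + 1)) (dt i) *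
      (T' wmut * yElt q T' (conjP fun s => mu (s + 1)))) = 0 := by
    have := hyp _ (hSt ▸ Submodule.mem_span_singleton_self _)
    simpa only [hψ'] using this
  intro z hz
  obtain ⟨b, rfl⟩ : ∃ b : H, xElt T mu * (T wmu * yElt q T (conjP mu) * b) = z := by
    have hz' := hz
    rw [hSmu, Submodule.mem_span_singleton] at hz'
    obtain ⟨b, hb⟩ := hz'
    refine ⟨b.unop, ?_⟩
    rw [← hb, ← mul_assoc]
    rfl
  simp only [hφ', hX, hh₀]
  have hterm : ∀ i, c i • ((∑ w ∈ headReps n mu lam A0, T w) *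
      j (XPhi T' lamt (fun s => mu (s + 1)) (dt i)) *
      (j (T' wmut) * j (yElt q T' (conjP fun s => mu (s + 1))) * h₀ * b)) =
      (∑ w ∈ headReps n mu lam A0, T w) *
        j (c i • (XPhi T' lamt (fun s => mu (s + 1)) (dt i) *
          (T' wmut * yElt q T' (conjP fun s => mu (s + 1))))) * (h₀ * b) := by
    intro i
    simp only [map_smul, hjm, mul_smul_comm, smul_mul_assoc, mul_assoc]
  simp only [hterm]
  rw [← Finset.sum_mul, ← Finset.mul_sum, ← map_sum, hzero, map_zero, mul_zero, zero_mul]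

end FayersSemistd
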